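/- arXiv:2108.10659 — 7 statements merged into one kernel-verified Lean document; each statement's English description precedes it below -/
import Mathlib

section
/- Let (X,d) be a metric space, m a Borel measure on X, p ∈ X, R > 0 and N > 1 a real number, and assume 0 < m(B_R(p)) < ∞. Assume the annulus volume comparison: for every δ ∈ (0,1), m(B_R(p) \ B_{δR}(p)) ≤ (1 − δ^N) · m(B_R(p)). Then for every real number m0 ≥ 1, setting δ := (1 − 1/(2·m0))^{1/N}, every Borel set W ⊆ B_R(p) with m(W) ≥ m(B_R(p))/m0 contains a point q with d(q,p) ≤ δ·R; moreover, for any q with d(q,p) ≤ δ·R one has B_{(1−δ)R}(q) ⊆ B_R(p). -/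
open Metric MeasureTheory Set

/-- Key technical lemma (Lemma 3.1): given the annulus volume comparison coming from
Bishop–Gromov, any subset of `B_R(p)` of measure at least `m(B_R(p))/m0` contains a point
`q` at distance at most `δ·R` from `p`, with `δ = (1 - 1/(2 m0))^(1/N)`; moreover for any
such `q`, `B_{(1-δ)R}(q) ⊆ B_R(p)`. -/
theorem stmt0 {X : Type*} [MetricSpace X] [MeasurableSpace X] [BorelSpace X]
    (m : Measure X) (p : X) (R N : ℝ) (hR : 0 < R) (hN : 1 < N)
    (hpos : 0 < m (ball p R)) (hfin : m (ball p R) < ⊤)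
    (hannulus : ∀ δ : ℝ, δ ∈ Set.Ioo (0 : ℝ) 1 →
      m (ball p R \ ball p (δ * R)) ≤ ENNReal.ofReal (1 - δ ^ N) * m (ball p R)) :
    ∀ m0 : ℝ, 1 ≤ m0 →
      (∀ W : Set X, MeasurableSet W → W ⊆ ball p R →
          m (ball p R) / ENNReal.ofReal m0 ≤ m W →
          ∃ q ∈ W, dist q p ≤ (1 - 1 / (2 * m0)) ^ (1 / N) * R) ∧
      (∀ q : X, dist q p ≤ (1 - 1 / (2 * m0)) ^ (1 / N) * R →
          ball q ((1 - (1 - 1 / (2 * m0)) ^ (1 / N)) * R) ⊆ ball p R) := by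
  intro m0 hm0
  have hm0_pos : 0 < m0 := by linarith
  refine ⟨fun W _ hWB hW => ?_, fun q hq => ball_subset_ball' (by linarith)⟩
  set δ : ℝ := (1 - 1 / (2 * m0)) ^ (1 / N) with hδ
  have hhalf : 1 / (2 * m0) < 1 := by
    rw [div_lt_one (by positivity)]
    linarith
  have hinv : 0 < 1 / (2 * m0) := by positivity
  have hδN : δ ^ N = 1 - 1 / (2 * m0) := by
    rw [hδ, one_div N, Real.rpow_inv_rpow (by linarith) (by linarith)]
  have hδ_pos : 0 < δ := Real.rpow_pos_of_pos (by linarith) _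
  have hδ_lt : δ < 1 := Real.rpow_lt_one (by linarith) (by linarith) (by positivity)
  by_contra! hfar
  have hW_sub : W ⊆ ball p R \ ball p (δ * R) := fun q hq =>
    ⟨hWB hq, fun hqδ => (hfar q hq).not_gt (mem_ball.mp hqδ)⟩
  have hle := hW.trans ((measure_mono hW_sub).trans (hannulus δ ⟨hδ_pos, hδ_lt⟩))
  rw [hδN, sub_sub_cancel, div_eq_mul_inv, mul_comm,
    ENNReal.mul_le_mul_iff_left hpos.ne' hfin.ne, ← ENNReal.ofReal_inv_of_pos hm0_pos,
    ENNReal.ofReal_le_ofReal_iff hinv.le, one_div, inv_le_inv₀ hm0_pos (by positivity)] at hle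
  linarith
end

section
/- Let (X,d) be a metric space and m a Borel measure on X with 0 < m(B_s(x)) < ∞ for all x ∈ X and s > 0. Let N > 1 be real and define V(s) = ∫_0^s sinh(t)^{N−1} dt. Assume the Bishop–Gromov inequality: for all x ∈ X and all 0 < r ≤ R, m(B_r(x)) · V(R) ≥ m(B_R(x)) · V(r). Let p0 ∈ X, D > 0, λ > 2, and let q_1, …, q_m be m distinct points of X with d(q_a, p0) = λD for all a and d(q_a, q_b) ≥ D for all a ≠ b. Then m ≤ V((2λ + 1/2)·D) / V(D/2). -/
open Metric MeasureTheory Set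

/-- The integral `∫₀ˢ sinh(t)^c dt` is positive for `s > 0` and `c ≥ 0`. -/
theorem integral_sinh_rpow_pos {c s : ℝ} (hc : 0 ≤ c) (hs : 0 < s) :
    0 < ∫ t in (0 : ℝ)..s, Real.sinh t ^ c := by
  refine intervalIntegral.intervalIntegral_pos_of_pos_on ?_ ?_ hs
  · exact (Real.continuous_sinh.rpow_const fun _ => Or.inr hc).intervalIntegrable 0 s
  · intro t ht
    exact Real.rpow_pos_of_pos (Real.sinh_pos_iff.2 ht.1) c

/-- If finitely many pairwise disjoint measurable sets, each of measure at least `m`, lie in `T`,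
then their number times `m` is at most the measure of `T`. -/
theorem card_mul_le_measure_of_pairwise_disjoint {ι X : Type*} [Fintype ι] [MeasurableSpace X]
    {μ : Measure X} {S : ι → Set X} {T : Set X} {m : ENNReal}
    (hS : ∀ i, MeasurableSet (S i)) (hdisj : Pairwise (Function.onFun Disjoint S))
    (hm : ∀ i, m ≤ μ (S i)) (hT : ∀ i, S i ⊆ T) :
    (Fintype.card ι : ENNReal) * m ≤ μ T :=
  calc (Fintype.card ι : ENNReal) * m = ∑ _i : ι, m := by simp
    _ ≤ ∑ i, μ (S i) := Finset.sum_le_sum fun i _ => hm i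
    _ = μ (⋃ i, S i) := by rw [measure_iUnion hdisj hS, tsum_fintype]
    _ ≤ μ T := measure_mono (iUnion_subset hT)

/-- Packing bound (inequality (3.2)): under the Bishop–Gromov inequality for `CD(-1,N)`,
the number `n` of `D`-separated points on the sphere of radius `λ·D` around `p0` is at most
`V((2λ + 1/2)·D) / V(D/2)` where `V(s) = ∫_0^s sinh(t)^(N-1) dt`. -/
theorem stmt1 {X : Type*} [MetricSpace X] [MeasurableSpace X] [BorelSpace X]
    (μ : Measure X)
    (hvol : ∀ (x : X) (s : ℝ), 0 < s → 0 < μ (ball x s) ∧ μ (ball x s) < ⊤)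
    (N : ℝ) (hN : 1 < N)
    (V : ℝ → ℝ) (hV : ∀ s : ℝ, V s = ∫ t in (0 : ℝ)..s, Real.sinh t ^ (N - 1))
    (hBG : ∀ (x : X) (r R : ℝ), 0 < r → r ≤ R →
      μ (ball x R) * ENNReal.ofReal (V r) ≤ μ (ball x r) * ENNReal.ofReal (V R))
    (p0 : X) (D lam : ℝ) (hD : 0 < D) (hlam : 2 < lam)
    (n : ℕ) (q : Fin n → X) (hinj : Function.Injective q)
    (hsphere : ∀ a : Fin n, dist (q a) p0 = lam * D)
    (hsep : ∀ a b : Fin n, a ≠ b → D ≤ dist (q a) (q b)) :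
    (n : ℝ) ≤ V ((2 * lam + 1 / 2) * D) / V (D / 2) := by
  have hVpos : ∀ s : ℝ, 0 < s → 0 < V s := fun s hs => by
    rw [hV]
    exact integral_sinh_rpow_pos (by linarith) hs
  have hr : 0 < D / 2 := by positivity
  have hrR : D / 2 ≤ (2 * lam + 1 / 2) * D := by nlinarith
  have hVr := hVpos _ hr
  have hVR := hVpos _ (hr.trans_le hrR)
  rcases isEmpty_or_nonempty (Fin n) with hn | hn
  · rw [← Fintype.card_fin n, Fintype.card_eq_zero, Nat.cast_zero]
    exact (div_pos hVR hVr).le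
  obtain ⟨s, hs⟩ := Finite.exists_min fun a => μ (ball (q a) (D / 2))
  have hdisj : Pairwise (Function.onFun Disjoint fun a => ball (q a) (D / 2)) := fun a b hab =>
    ball_disjoint_ball (by linarith [hsep a b hab])
  have hsub : ∀ a, ball (q a) (D / 2) ⊆ ball (q s) ((2 * lam + 1 / 2) * D) := fun a =>
    ball_subset_ball' (by
      linarith [dist_triangle_right (q a) (q s) p0, hsphere a, hsphere s])
  have hcard := card_mul_le_measure_of_pairwise_disjoint (fun _ => measurableSet_ball) hdisj hs hsub
  rw [Fintype.card_fin] at hcard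
  obtain ⟨hpos, hfin⟩ := hvol (q s) (D / 2) hr
  have hmul : μ (ball (q s) (D / 2)) * (n * ENNReal.ofReal (V (D / 2))) ≤
      μ (ball (q s) (D / 2)) * ENNReal.ofReal (V ((2 * lam + 1 / 2) * D)) :=
    calc μ (ball (q s) (D / 2)) * (n * ENNReal.ofReal (V (D / 2)))
        = n * μ (ball (q s) (D / 2)) * ENNReal.ofReal (V (D / 2)) := by ring
      _ ≤ μ (ball (q s) ((2 * lam + 1 / 2) * D)) * ENNReal.ofReal (V (D / 2)) := by gcongr
      _ ≤ _ := hBG (q s) _ _ hr hrR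
  have hle := (ENNReal.mul_le_mul_iff_right hpos.ne' hfin.ne).1 hmul
  rw [← ENNReal.ofReal_natCast, ← ENNReal.ofReal_mul n.cast_nonneg,
    ENNReal.ofReal_le_ofReal_iff hVR.le] at hle
  exact (le_div_iff₀ hVr).2 hle
end

section
/- Let (X,d) be a metric space, p0 ∈ X, D > 0 and λ ≥ 2. Let x_1, x_2, u_1, u_2 ∈ X satisfy, for i = 1, 2: d(p0, u_i) = λD and d(p0, u_i) + d(u_i, x_i) = d(p0, x_i); and suppose d(u_1, u_2) ≤ 2D. Then every point y ∈ X with d(x_1, y) + d(y, x_2) = d(x_1, x_2) satisfies d(y, p0) ≥ (λ − 1)·D; in particular d(y, p0) ≥ λD/2. -/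
open Metric

/-- If `x₁, x₂` lie in the same cone (their geodesics from `p0` pass through points
`u₁, u₂` at distance `λ·D` from `p0` with `d(u₁,u₂) ≤ 2D`), then every point on a minimal
geodesic between `x₁` and `x₂` is at distance at least `(λ-1)·D ≥ λ·D/2` from `p0`. -/
theorem stmt2 {X : Type*} [MetricSpace X] (p0 : X) (D lam : ℝ)
    (hD : 0 < D) (hlam : 2 ≤ lam)
    (x₁ x₂ u₁ u₂ : X)
    (hu₁ : dist p0 u₁ = lam * D) (hu₂ : dist p0 u₂ = lam * D)
    (hgeo₁ : dist p0 u₁ + dist u₁ x₁ = dist p0 x₁)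
    (hgeo₂ : dist p0 u₂ + dist u₂ x₂ = dist p0 x₂)
    (huu : dist u₁ u₂ ≤ 2 * D) :
    ∀ y : X, dist x₁ y + dist y x₂ = dist x₁ x₂ →
      (lam - 1) * D ≤ dist y p0 ∧ lam * D / 2 ≤ dist y p0 := by
  intro y hy
  have hx₁ : dist p0 x₁ ≤ dist y p0 + dist x₁ y := by
    simpa only [dist_comm] using dist_triangle p0 y x₁
  have hx₂ : dist p0 x₂ ≤ dist y p0 + dist y x₂ := by
    simpa only [dist_comm] using dist_triangle p0 y x₂
  have hxx : dist x₁ x₂ ≤ dist u₁ x₁ + dist u₁ u₂ + dist u₂ x₂ := by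
    simpa only [dist_comm] using dist_triangle4 x₁ u₁ u₂ x₂
  have hy₀ : (lam - 1) * D ≤ dist y p0 := by linarith
  exact ⟨hy₀, by nlinarith⟩
end

section
/- Let (X,d) be a metric space, p0 ∈ X, D > 0, λ > 2 and 0 < ε0 < (λ−2)·D/2. Let q, x, y, z, w ∈ X satisfy: d(q,y) + d(y,x) ≤ d(q,p0) + d(x,p0) − 2λD + 2D; d(z,q) ≤ ε0; and d(z,w) + d(w,y) = d(z,y). Then d(w, p0) > λD/2. -/
open Metric

/-- Any geodesic joining a point `z` of the ball `B_{ε0}(q)` with a point `y` of the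
star-shaped set `W_q` stays outside the ball `B_{λD/2}(p0)`. -/
theorem stmt3 {X : Type*} [MetricSpace X] (p0 : X) (D lam ε0 : ℝ)
    (hD : 0 < D) (hlam : 2 < lam) (hε0 : 0 < ε0) (hε0' : ε0 < (lam - 2) * D / 2)
    (q x y z w : X)
    (hxy : dist q y + dist y x ≤ dist q p0 + dist x p0 - 2 * lam * D + 2 * D)
    (hz : dist z q ≤ ε0)
    (hw : dist z w + dist w y = dist z y) :
    lam * D / 2 < dist w p0 := by
  have hqp : dist q p0 ≤ dist z q + dist z w + dist w p0 := by
    simpa only [dist_comm q z] using dist_triangle4 q z w p0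
  have hxp : dist x p0 ≤ dist y x + dist w y + dist w p0 := by
    simpa only [dist_comm x y, dist_comm y w] using dist_triangle4 x y w p0
  have hzy : dist z y ≤ dist z q + dist q y := dist_triangle z q y
  linarith
end

section
/- Let ν be a Borel measure on the real line, let N ≥ 1 be a real number and R0 > 0. Assume that for all 0 < s ≤ S and all η > 0 with (1+η)·S ≤ R0 one has ν((s, (1+η)s]) ≥ (s/S)^N · ν((S, (1+η)S]). Then for all 0 < r ≤ R ≤ R0, ν((0, r]) ≥ (r/R)^N · ν((0, R]). -/
open MeasureTheory Set

/-- The interval `(0, R]` is partitioned by the dyadic annuli `(R / 2 ^ (k + 1), R / 2 ^ k]`. -/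
theorem measure_Ioc_zero_eq_tsum_dyadic (ν : Measure ℝ) {R : ℝ} (hR : 0 < R) :
    ν (Ioc 0 R) = ∑' k : ℕ, ν (Ioc (R / 2 ^ (k + 1)) (R / 2 ^ k)) := by
  have hanti : Antitone fun k : ℕ => R / 2 ^ k := fun a b hab => by
    have : (2 : ℝ) ^ a ≤ 2 ^ b := pow_le_pow_right₀ (by norm_num) hab
    dsimp only
    gcongr
  have hunion : Ioc 0 R = ⋃ k : ℕ, Ioc (R / 2 ^ (k + 1)) (R / 2 ^ k) := by
    ext x
    simp only [mem_iUnion, mem_Ioc]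
    constructor
    · rintro ⟨hx, hxR⟩
      obtain ⟨n, hn, hn'⟩ := exists_nat_pow_near ((one_le_div hx).2 hxR) one_lt_two
      refine ⟨n, ?_, ?_⟩
      · rw [div_lt_iff₀ hx] at hn'
        rw [div_lt_iff₀ (by positivity)]
        linarith
      · rw [le_div_iff₀ hx] at hn
        rw [le_div_iff₀ (by positivity)]
        linarith
    · rintro ⟨k, hk, hk'⟩
      exact ⟨lt_trans (by positivity) hk, by simpa using hk'.trans (hanti (Nat.zero_le k))⟩
  rw [hunion]
  exact measure_iUnion hanti.pairwise_disjoint_on_Ioc_succ fun _ => measurableSet_Ioc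

/-- Integration step in the Bishop–Gromov argument: the annulus comparison for a measure
on the real line implies the volume ratio bound `ν((0,r]) ≥ (r/R)^N · ν((0,R])`. -/
theorem stmt4 (ν : Measure ℝ) (N R0 : ℝ) (hN : 1 ≤ N) (hR0 : 0 < R0)
    (hannulus : ∀ s S η : ℝ, 0 < s → s ≤ S → 0 < η → (1 + η) * S ≤ R0 →
      ENNReal.ofReal ((s / S) ^ N) * ν (Set.Ioc S ((1 + η) * S)) ≤
        ν (Set.Ioc s ((1 + η) * s))) :
    ∀ r R : ℝ, 0 < r → r ≤ R → R ≤ R0 →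
      ENNReal.ofReal ((r / R) ^ N) * ν (Set.Ioc 0 R) ≤ ν (Set.Ioc 0 r) := by
  intro r R hr hrR hR
  have hRpos : 0 < R := hr.trans_le hrR
  rw [measure_Ioc_zero_eq_tsum_dyadic ν hRpos, measure_Ioc_zero_eq_tsum_dyadic ν hr,
    ← ENNReal.tsum_mul_left]
  refine ENNReal.tsum_le_tsum fun k => ?_
  have hdouble (t : ℝ) : (1 + 1) * (t / 2 ^ (k + 1)) = t / 2 ^ k := by
    field_simp
    ring
  have hratio : r / 2 ^ (k + 1) / (R / 2 ^ (k + 1)) = r / R :=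
    div_div_div_cancel_right₀ (by positivity) r R
  have hle : (1 + 1) * (R / 2 ^ (k + 1)) ≤ R0 := by
    rw [hdouble]
    exact (div_le_self hRpos.le (one_le_pow₀ one_le_two)).trans hR
  have h := hannulus (r / 2 ^ (k + 1)) (R / 2 ^ (k + 1)) 1 (by positivity) (by gcongr) one_pos hle
  rwa [hdouble, hdouble, hratio] at h
end

section
/- Let (X,d) be a geodesic metric space, p0 ∈ X and r > 0. Let E be a connected component of X ∖ closedBall(p0, r) which is unbounded (i.e. sup_{y ∈ E} d(p0, y) = ∞). Then there exists y ∈ E with d(p0, y) = 2r. -/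
open Metric Set

/-- In a geodesic metric space, every unbounded connected component of the complement of
the closed ball of radius `r` meets the sphere of radius `2r`. -/
theorem stmt5 {X : Type*} [MetricSpace X]
    (hgeo : ∀ x y : X, ∃ γ : ℝ → X, γ 0 = x ∧ γ (dist x y) = y ∧
      ∀ s ∈ Set.Icc (0 : ℝ) (dist x y), ∀ t ∈ Set.Icc (0 : ℝ) (dist x y),
        dist (γ s) (γ t) = |s - t|)
    (p0 : X) (r : ℝ) (hr : 0 < r) (E : Set X)
    (hE : ∃ x ∈ (closedBall p0 r)ᶜ, E = connectedComponentIn (closedBall p0 r)ᶜ x)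
    (hunb : ∀ M : ℝ, ∃ y ∈ E, M < dist p0 y) :
    ∃ y ∈ E, dist p0 y = 2 * r := by
  obtain ⟨x, -, rfl⟩ := hE
  obtain ⟨y, hyE, hy⟩ := hunb (2 * r)
  obtain ⟨γ, h0, h1, hγ⟩ := hgeo p0 y
  have hdist : ∀ t ∈ Icc (0 : ℝ) (dist p0 y), dist p0 (γ t) = t := fun t ht => by
    rw [← h0, hγ 0 ⟨le_rfl, dist_nonneg⟩ t ht, zero_sub, abs_neg, abs_of_nonneg ht.1]
  have hsub : Icc (2 * r) (dist p0 y) ⊆ Icc 0 (dist p0 y) := Icc_subset_Icc_left (by linarith)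
  have hcont : ContinuousOn γ (Icc (2 * r) (dist p0 y)) :=
    (LipschitzOnWith.of_dist_le_mul (K := 1) fun s hs t ht => by
      rw [hγ s (hsub hs) t (hsub ht), NNReal.coe_one, one_mul, Real.dist_eq]).continuousOn
  have hcompl : γ '' Icc (2 * r) (dist p0 y) ⊆ (closedBall p0 r)ᶜ := by
    rintro _ ⟨t, ht, rfl⟩
    rw [mem_compl_iff, mem_closedBall', hdist t (hsub ht)]
    linarith [ht.1]
  have hcomp := (isPreconnected_Icc.image γ hcont).subset_connectedComponentIn
    ⟨dist p0 y, right_mem_Icc.2 hy.le, h1⟩ hcompl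
  rw [← connectedComponentIn_eq hyE] at hcomp
  have hmem : 2 * r ∈ Icc (2 * r) (dist p0 y) := left_mem_Icc.2 hy.le
  exact ⟨γ (2 * r), hcomp (mem_image_of_mem γ hmem), hdist _ (hsub hmem)⟩
end

section
/- Let (X,d) be a geodesic metric space, p0 ∈ X and C a natural number. Assume the following ball covering property: for every r > 0 and every subset S ⊆ closedBall(p0, 2r) there exist points p_1, …, p_k ∈ S with k ≤ C such that S ⊆ ⋃_{j=1}^k B_r(p_j). Then for every r > 0, the set X ∖ closedBall(p0, r) has at most C unbounded connected components (a component E being unbounded if sup_{y ∈ E} d(p0, y) = ∞). -/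
open Metric Set

/-- The endpoints of a path that preserves distances and stays in `F` lie in the same connected
component of `F`. -/
theorem connectedComponentIn_eq_of_dist_eq {X : Type*} [MetricSpace X] {F : Set X} {γ : ℝ → X}
    {a b : ℝ} (hab : a ≤ b)
    (hγ : ∀ s ∈ Icc a b, ∀ t ∈ Icc a b, dist (γ s) (γ t) = |s - t|)
    (hF : ∀ t ∈ Icc a b, γ t ∈ F) :
    connectedComponentIn F (γ a) = connectedComponentIn F (γ b) := by
  have hc : ContinuousOn γ (Icc a b) := by
    refine (LipschitzOnWith.of_dist_le_mul (K := 1) fun s hs t ht => ?_).continuousOn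
    rw [hγ s hs t ht, NNReal.coe_one, one_mul, Real.dist_eq]
  refine connectedComponentIn_eq ?_
  exact (isPreconnected_Icc.image γ hc).subset_connectedComponentIn
    (mem_image_of_mem γ (left_mem_Icc.2 hab)) (image_subset_iff.2 hF)
    (mem_image_of_mem γ (right_mem_Icc.2 hab))

/-- The ball covering property implies that the complement of any closed ball has at most
`C` unbounded connected components. -/
theorem stmt8 {X : Type*} [MetricSpace X]
    (hgeo : ∀ x y : X, ∃ γ : ℝ → X, γ 0 = x ∧ γ (dist x y) = y ∧
      ∀ s ∈ Set.Icc (0 : ℝ) (dist x y), ∀ t ∈ Set.Icc (0 : ℝ) (dist x y),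
        dist (γ s) (γ t) = |s - t|)
    (p0 : X) (C : ℕ)
    (hcov : ∀ r : ℝ, 0 < r → ∀ S : Set X, S ⊆ closedBall p0 (2 * r) →
      ∃ (k : ℕ) (p : Fin k → X), k ≤ C ∧ (∀ j, p j ∈ S) ∧
        S ⊆ ⋃ j : Fin k, ball (p j) r) :
    ∀ r : ℝ, 0 < r →
      ∀ E : Fin (C + 1) → Set X,
        (∀ i, (∃ x ∈ (closedBall p0 r)ᶜ,
            E i = connectedComponentIn (closedBall p0 r)ᶜ x) ∧
          (∀ M : ℝ, ∃ y ∈ E i, M < dist p0 y)) →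
        ¬ Function.Injective E := by
  intro r hr E hE hinj
  have hz : ∀ i, ∃ z, dist p0 z = 2 * r ∧ E i = connectedComponentIn (closedBall p0 r)ᶜ z := by
    intro i
    obtain ⟨⟨x, -, hEx⟩, hunb⟩ := hE i
    obtain ⟨y, hy, hyr⟩ := hunb (2 * r)
    obtain ⟨γ, h0, h1, hγ⟩ := hgeo p0 y
    have hd : ∀ t ∈ Icc (0 : ℝ) (dist p0 y), dist p0 (γ t) = t := fun t ht => by
      have h := hγ 0 ⟨le_rfl, dist_nonneg⟩ t ht
      rwa [h0, zero_sub, abs_neg, abs_of_nonneg ht.1] at h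
    have hsub : Icc (2 * r) (dist p0 y) ⊆ Icc 0 (dist p0 y) := Icc_subset_Icc_left (by linarith)
    refine ⟨γ (2 * r), hd _ (hsub (left_mem_Icc.2 hyr.le)), ?_⟩
    rw [connectedComponentIn_eq_of_dist_eq hyr.le
      (fun s hs t ht => hγ s (hsub hs) t (hsub ht)) (fun t ht => ?_), h1, hEx]
    · exact connectedComponentIn_eq (hEx ▸ hy)
    · rw [mem_compl_iff, mem_closedBall', hd t (hsub ht)]
      linarith [ht.1]
  choose z hzd hzE using hz
  have hnear : ∀ i j, dist (z i) (z j) < r → i = j := by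
    intro i j hij
    obtain ⟨γ, h0, h1, hγ⟩ := hgeo (z i) (z j)
    refine hinj ?_
    rw [hzE i, hzE j, ← h0, ← h1]
    refine connectedComponentIn_eq_of_dist_eq dist_nonneg hγ fun t ht => ?_
    have hs := hγ 0 (left_mem_Icc.2 dist_nonneg) t ht
    have he := hγ _ (right_mem_Icc.2 dist_nonneg) t ht
    rw [h0, zero_sub, abs_neg, abs_of_nonneg ht.1] at hs
    rw [h1, abs_of_nonneg (sub_nonneg.2 ht.2)] at he
    rw [mem_compl_iff, mem_closedBall', not_le]
    have ti := dist_triangle_right p0 (z i) (γ t)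
    have tj := dist_triangle_right p0 (z j) (γ t)
    linarith [hzd i, hzd j]
  obtain ⟨k, p, hk, hp, hS⟩ := hcov r hr (range z) (by
    rintro _ ⟨i, rfl⟩
    exact mem_closedBall'.2 (hzd i).le)
  choose m hm using hp
  have hsurj : Function.Surjective m := fun i => by
    obtain ⟨j, hj⟩ := mem_iUnion.1 (hS (mem_range_self i))
    rw [← hm j] at hj
    exact ⟨j, (hnear i (m j) hj).symm⟩
  have hcard := Fintype.card_le_of_surjective m hsurj
  simp only [Fintype.card_fin] at hcard
  omega
end
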